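/- arXiv:1911.03910 — 4 statements merged into one kernel-verified Lean document; each statement's English description precedes it below -/
import Mathlib

section
/- Let (X,‖·‖_X) be a real Banach space continuously embedded in a real Banach space (W,‖·‖_W), let J : X → ℝ be continuously Fréchet differentiable, and let c ∈ ℝ. Assume that J satisfies the (wCPS)_c condition and that the critical set K_J^c = {u ∈ X : J(u) = c, dJ(u) = 0} is empty. Then for every ε̄ > 0 there exist a constant ε > 0 with 2ε < ε̄ and a homeomorphism ψ : X → X such that: (i) ψ maps the sublevel {u ∈ X : J(u) ≤ c+ε} into {u ∈ X : J(u) ≤ c−ε}; (ii) ψ(u) = u for every u ∈ X with J(u) ≤ c−ε̄ or J(u) ≥ c+ε̄. Moreover, if J is even on X, then ψ can be chosen odd. -/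
open Filter

/-- A Cerami--Palais--Smale sequence at level `c` for `J : X → ℝ`:
`J (u n) → c` and `‖dJ(u n)‖ (1 + ‖u n‖) → 0`. -/
def IsCPSSeq {X : Type*} [NormedAddCommGroup X] [NormedSpace ℝ X]
    (J : X → ℝ) (c : ℝ) (u : ℕ → X) : Prop :=
  Tendsto (fun n => J (u n)) atTop (nhds c) ∧
    Tendsto (fun n => ‖fderiv ℝ J (u n)‖ * (1 + ‖u n‖)) atTop (nhds 0)

/-- The weak Cerami--Palais--Smale condition at level `c`, relative to the continuous
embedding `ι : X → W`: every `(CPS)_c`-sequence has a subsequence converging in the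
`W`-norm to some `v ∈ X` with `J v = c` and `dJ(v) = 0`. -/
def WCPS {X W : Type*} [NormedAddCommGroup X] [NormedSpace ℝ X]
    [NormedAddCommGroup W] [NormedSpace ℝ W]
    (ι : X →L[ℝ] W) (J : X → ℝ) (c : ℝ) : Prop :=
  ∀ u : ℕ → X, IsCPSSeq J c u →
    ∃ v : X, ∃ φ : ℕ → ℕ, StrictMono φ ∧
      Tendsto (fun n => ‖ι (u (φ n)) - ι v‖) atTop (nhds 0) ∧
      J v = c ∧ fderiv ℝ J v = 0

section Flow

open Set
open scoped Topology NNReal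

variable {E : Type*} [NormedAddCommGroup E] [NormedSpace ℝ E]

lemma IsIntegralCurveAt.congr_nhds {v : ℝ → E → E} {γ γ' : ℝ → E} {t : ℝ}
    (h : IsIntegralCurveAt γ v t) (e : γ' =ᶠ[𝓝 t] γ) : IsIntegralCurveAt γ' v t := by
  filter_upwards [h, e.eventually_nhds] with s hs he
  rw [Filter.EventuallyEq.eq_of_nhds he]
  exact hs.congr_of_eventuallyEq he

variable {V : E → E}

lemma LocallyLipschitz.integralCurve_eventuallyEq (hV : LocallyLipschitz V) {γ η : ℝ → E} {t : ℝ}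
    (hγ : IsIntegralCurveAt γ (fun _ ↦ V) t) (hη : IsIntegralCurveAt η (fun _ ↦ V) t)
    (h : γ t = η t) : γ =ᶠ[𝓝 t] η := by
  obtain ⟨K, s, hs, hK⟩ := hV (γ t)
  exact ODE_solution_unique_of_eventually (v := fun _ ↦ V) (s := fun _ ↦ s) (K := K)
    (.of_forall fun _ ↦ hK) (hγ.and (hγ.continuousAt.eventually_mem hs))
    (hη.and (hη.continuousAt.eventually_mem (h ▸ hs))) h

lemma LocallyLipschitz.integralCurve_eqOn (hV : LocallyLipschitz V) {γ η : ℝ → E} {S : Set ℝ}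
    (hS : IsPreconnected S) (hγ : ∀ t ∈ S, IsIntegralCurveAt γ (fun _ ↦ V) t)
    (hη : ∀ t ∈ S, IsIntegralCurveAt η (fun _ ↦ V) t) {t₀ : ℝ} (ht₀ : t₀ ∈ S)
    (h : γ t₀ = η t₀) : EqOn γ η S := by
  intro t ht
  refine (hS.induction₂ (fun x y ↦ (γ x = η x ↔ γ y = η y)) (fun x hx ↦ ?_)
    (fun x y z _ _ _ h₁ h₂ ↦ h₁.trans h₂) (fun x y _ _ h ↦ h.symm) ht₀ ht).1 h
  apply Filter.Eventually.filter_mono nhdsWithin_le_nhds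
  by_cases hxy : γ x = η x
  · filter_upwards [hV.integralCurve_eventuallyEq (hγ x hx) (hη x hx) hxy] with y hy
    exact iff_of_true hxy hy
  · filter_upwards [((hγ x hx).continuousAt.sub (hη x hx).continuousAt).eventually_ne
      (sub_ne_zero.2 hxy)] with y hy
    replace hy := sub_ne_zero.1 hy
    exact iff_of_false hxy hy

lemma LocallyLipschitz.integralCurve_unique (hV : LocallyLipschitz V) {γ η : ℝ → E}
    (hγ : IsIntegralCurve γ (fun _ ↦ V)) (hη : IsIntegralCurve η (fun _ ↦ V)) {t₀ : ℝ}
    (h : γ t₀ = η t₀) : γ = η :=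
  funext fun t ↦ hV.integralCurve_eqOn isPreconnected_univ (fun t _ ↦ hγ.isIntegralCurveAt t)
    (fun t _ ↦ hη.isIntegralCurveAt t) (mem_univ t₀) h (mem_univ t)

lemma LocallyLipschitz.exists_local_flow [CompleteSpace E] (hV : LocallyLipschitz V) (p : E) :
    ∃ τ > 0, ∃ N ∈ 𝓝 p, ∃ α : E × ℝ → E,
      (∀ x ∈ N, α (x, 0) = x ∧
        ∀ t ∈ Ioo (-τ) τ, IsIntegralCurveAt (fun s ↦ α (x, s)) (fun _ ↦ V) t) ∧
      ContinuousOn α (N ×ˢ Ioo (-τ) τ) := by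
  obtain ⟨K, s, hs, hK⟩ := hV p
  have hb : ∀ᶠ x in 𝓝 p, ‖V x‖ < ‖V p‖ + 1 :=
    hV.continuous.norm.continuousAt.eventually_lt_const (lt_add_one _)
  obtain ⟨a, ha, has⟩ := Metric.nhds_basis_closedBall.mem_iff.1 (inter_mem hs hb)
  set L : ℝ≥0 := ‖V p‖₊ + 1
  have hL : (0 : ℝ) < L := by positivity
  set τ : ℝ := a / 2 / L
  have hτ : 0 < τ := by positivity
  have hPL : IsPicardLindelof (fun _ ↦ V) (tmin := -τ) (tmax := τ) ⟨0, by simp [hτ.le]⟩ p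
      ⟨a, ha.le⟩ ⟨a / 2, (half_pos ha).le⟩ L K := by
    refine .of_time_independent (fun x hx ↦ (has hx).2.le) (hK.mono fun x hx ↦ (has hx).1) ?_
    have : (L : ℝ) * τ = a / 2 := by simp only [τ]; field_simp
    change (L : ℝ) * max (τ - 0) (0 - -τ) ≤ a - a / 2
    rw [sub_zero, zero_sub, neg_neg, max_self, this, sub_half]
  obtain ⟨α, hα, hc⟩ := hPL.exists_forall_mem_closedBall_eq_hasDerivWithinAt_continuousOn
  refine ⟨τ, hτ, Metric.closedBall p (a / 2), Metric.closedBall_mem_nhds _ (half_pos ha), α,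
    fun x hx ↦ ⟨(hα x hx).1, fun t ht ↦ ?_⟩,
    hc.mono (prod_mono subset_rfl Ioo_subset_Icc_self)⟩
  exact IsIntegralCurveOn.isIntegralCurveAt (s := Icc (-τ) τ) (hα x hx).2 (Icc_mem_nhds ht.1 ht.2)

lemma norm_integralCurve_le_of_nonneg {C : ℝ} (hC : ∀ x, ‖V x‖ ≤ C * ‖x‖ + C) {γ : ℝ → E}
    {S : Set ℝ} (hS : IsPreconnected S) (hγ : ∀ t ∈ S, IsIntegralCurveAt γ (fun _ ↦ V) t)
    (h0 : 0 ∈ S) {t : ℝ} (ht : t ∈ S) (ht0 : 0 ≤ t) :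
    ‖γ t‖ ≤ gronwallBound ‖γ 0‖ C C t := by
  have hsub : Icc 0 t ⊆ S := hS.Icc_subset h0 ht
  simpa using norm_le_gronwallBound_of_norm_deriv_right_le (f := γ) (f' := fun s ↦ V (γ s))
    (δ := ‖γ 0‖) (K := C) (ε := C) (a := 0) (b := t)
    (fun s hs ↦ (hγ s (hsub hs)).continuousAt.continuousWithinAt)
    (fun s hs ↦ (hγ s (hsub (Ico_subset_Icc_self hs))).hasDerivAt.hasDerivWithinAt)
    le_rfl (fun s _ ↦ hC _) t (right_mem_Icc.2 ht0)

lemma norm_integralCurve_le {C : ℝ} (hC : ∀ x, ‖V x‖ ≤ C * ‖x‖ + C) {γ : ℝ → E}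
    {S : Set ℝ} (hS : IsPreconnected S) (hγ : ∀ t ∈ S, IsIntegralCurveAt γ (fun _ ↦ V) t)
    (h0 : 0 ∈ S) {t : ℝ} (ht : t ∈ S) :
    ‖γ t‖ ≤ gronwallBound ‖γ 0‖ C C |t| := by
  rcases le_total 0 t with h | h
  · rw [abs_of_nonneg h]
    exact norm_integralCurve_le_of_nonneg hC hS hγ h0 ht h
  · rw [abs_of_nonpos h]
    have hγ' : ∀ s ∈ -S, IsIntegralCurveAt (fun r ↦ γ (-r)) (fun _ x ↦ -V x) s := by
      intro s hs
      have := (tendsto_id.neg : Tendsto (fun r : ℝ ↦ -r) (𝓝 s) (𝓝 (-s))).eventually (hγ (-s) hs)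
      filter_upwards [this] with r hr
      simpa [Function.comp_def] using hr.scomp r (hasDerivAt_neg r)
    have hS' : IsPreconnected (-S) := by
      rw [← image_neg_eq_neg]
      exact hS.image _ continuous_neg.continuousOn
    simpa using norm_integralCurve_le_of_nonneg (V := fun x ↦ -V x) (by simpa using hC) hS' hγ'
      (by simpa using h0) (t := -t) (by simpa using ht) (by linarith)

/-- A locally Lipschitz vector field of linear growth on a Banach space has global integral curves
through every point. -/
lemma LocallyLipschitz.exists_integralCurve [CompleteSpace E] (hV : LocallyLipschitz V) {C : ℝ}
    (hC : ∀ x, ‖V x‖ ≤ C * ‖x‖ + C) (x : E) :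
    ∃ γ : ℝ → E, γ 0 = x ∧ IsIntegralCurve γ (fun _ ↦ V) := by
  classical
  have hC0 : 0 ≤ C := by simpa using (norm_nonneg _).trans (hC 0)
  -- `D` is the maximal domain and `Γ` the maximal solution.
  let Sol (γ : ℝ → E) (S : Set ℝ) : Prop := IsOpen S ∧ IsPreconnected S ∧ 0 ∈ S ∧ γ 0 = x ∧
    ∀ s ∈ S, IsIntegralCurveAt γ (fun _ ↦ V) s
  let D : Set ℝ := {t | ∃ γ S, Sol γ S ∧ t ∈ S}
  choose! γ S hγS using show ∀ t ∈ D, ∃ γ S, Sol γ S ∧ t ∈ S from fun t ht ↦ ht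
  let Γ : ℝ → E := fun t ↦ γ t t
  have hDsub {η : ℝ → E} {U : Set ℝ} (h : Sol η U) : U ⊆ D := fun t ht ↦ ⟨η, U, h, ht⟩
  have hΓ {η : ℝ → E} {U : Set ℝ} (h : Sol η U) : EqOn Γ η U := by
    intro t ht
    obtain ⟨⟨h1, h2, h3, h4, h5⟩, h6⟩ := hγS t (hDsub h ht)
    have hpre : IsPreconnected (S t ∩ U) :=
      (h2.ordConnected.inter h.2.1.ordConnected).isPreconnected
    exact hV.integralCurve_eqOn hpre (fun s hs ↦ h5 s hs.1) (fun s hs ↦ h.2.2.2.2 s hs.2)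
      ⟨h3, h.2.2.1⟩ (h4.trans h.2.2.2.1.symm) ⟨h6, ht⟩
  have h0D : (0 : ℝ) ∈ D := by
    obtain ⟨τ, hτ, N, hN, α, hα, -⟩ := hV.exists_local_flow x
    obtain ⟨h1, h2⟩ := hα x (mem_of_mem_nhds hN)
    exact ⟨_, _, ⟨isOpen_Ioo, isPreconnected_Ioo, by simpa using hτ, h1, h2⟩, by simpa using hτ⟩
  have hDΓ : ∀ t ∈ D, IsIntegralCurveAt Γ (fun _ ↦ V) t := by
    rintro t ⟨η, U, h, ht⟩
    exact (h.2.2.2.2 t ht).congr_nhds ((hΓ h).eventuallyEq_of_mem (h.1.mem_nhds ht))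
  have hDopen : IsOpen D := by
    refine isOpen_iff_mem_nhds.2 ?_
    rintro t ⟨η, U, h, ht⟩
    exact mem_of_superset (h.1.mem_nhds ht) (hDsub h)
  have hDpre : IsPreconnected D := by
    refine isPreconnected_of_forall 0 ?_
    rintro t ⟨η, U, h, ht⟩
    exact ⟨U, hDsub h, h.2.2.1, ht, h.2.1⟩
  have hΓ0 : Γ 0 = x := (hγS 0 h0D).1.2.2.2.1
  have hDclosed : IsClosed D := by
    refine isClosed_of_closure_subset fun T hT ↦ ?_
    set R : ℝ := |T| + 1
    have hTR : T ∈ Ioo (-R) R := abs_lt.1 (lt_add_one _)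
    have hT' : T ∈ closure (Ioo (-R) R ∩ D) :=
      isOpen_Ioo.inter_closure ⟨hTR, hT⟩
    set M : ℝ := gronwallBound ‖x‖ C C R
    have hbound : ∀ t ∈ Ioo (-R) R ∩ D, ‖V (Γ t)‖₊ ≤ (C * M + C).toNNReal := by
      intro t ht
      rw [← NNReal.coe_le_coe, coe_nnnorm]
      refine le_trans ?_ (Real.le_coe_toNNReal _)
      have h1 : ‖Γ t‖ ≤ M := by
        refine (norm_integralCurve_le hC hDpre hDΓ h0D ht.2).trans ?_
        rw [hΓ0]
        exact gronwallBound_mono (norm_nonneg _) hC0 hC0 (abs_lt.2 ht.1).le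
      exact (hC _).trans (by gcongr)
    have hlip : LipschitzOnWith (C * M + C).toNNReal Γ (Ioo (-R) R ∩ D) :=
      Convex.lipschitzOnWith_of_nnnorm_hasDerivWithin_le
        ((convex_Ioo _ _).inter hDpre.ordConnected.convex)
        (fun t ht ↦ (hDΓ t ht.2).hasDerivAt.hasDerivWithinAt) hbound
    obtain ⟨u, hu, huT⟩ := mem_closure_iff_seq_limit.1 hT'
    obtain ⟨p, hp⟩ := cauchySeq_tendsto_of_complete
      (hlip.cauchySeq_comp huT.cauchySeq (range_subset_iff.2 hu))
    obtain ⟨τ, hτ, N, hN, α, hα, -⟩ := hV.exists_local_flow p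
    obtain ⟨n, hnN, hnT⟩ := ((hp.eventually hN).and
      (huT.eventually (Metric.ball_mem_nhds T hτ))).exists
    set t₁ := u n
    have ht₁ : t₁ ∈ D := (hu n).2
    obtain ⟨hα0, hαt⟩ := hα _ hnN
    let η : ℝ → E := fun s ↦ α (Γ t₁, s - t₁)
    let U : Set ℝ := Metric.ball t₁ τ
    have hη : ∀ s ∈ U, IsIntegralCurveAt η (fun _ ↦ V) s := by
      intro s hs
      rw [Metric.mem_ball, Real.dist_eq, abs_lt] at hs
      have := (hαt (s - t₁) hs).comp_sub t₁
      simpa [Function.comp_def] using this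
    have hTU : T ∈ U := Metric.mem_ball_comm.1 hnT
    have heq : EqOn Γ η (D ∩ U) := by
      refine hV.integralCurve_eqOn ?_ (fun s hs ↦ hDΓ s hs.1) (fun s hs ↦ hη s hs.2)
        (t₀ := t₁) ⟨ht₁, Metric.mem_ball_self hτ⟩ ?_
      · refine (hDpre.ordConnected.inter ?_).isPreconnected
        exact (convex_ball _ _).ordConnected
      · simpa [η] using hα0.symm
    have heqη : EqOn (D.piecewise Γ η) η U := by
      intro s hs
      by_cases hsD : s ∈ D
      · rw [piecewise_eq_of_mem _ _ _ hsD]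
        exact heq ⟨hsD, hs⟩
      · rw [piecewise_eq_of_notMem _ _ _ hsD]
    refine ⟨D.piecewise Γ η, D ∪ U, ⟨hDopen.union Metric.isOpen_ball, ?_, .inl h0D, ?_, ?_⟩,
      .inr hTU⟩
    · exact hDpre.union t₁ ht₁ (Metric.mem_ball_self hτ) (convex_ball _ _).isPreconnected
    · rw [piecewise_eq_of_mem _ _ _ h0D, hΓ0]
    · rintro s (hs | hs)
      · exact (hDΓ s hs).congr_nhds
          ((piecewise_eqOn D Γ η).eventuallyEq_of_mem (hDopen.mem_nhds hs))
      · exact (hη s hs).congr_nhds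
          (heqη.eventuallyEq_of_mem (Metric.isOpen_ball.mem_nhds hs))
  have hD : D = univ := IsClopen.eq_univ ⟨hDclosed, hDopen⟩ ⟨0, h0D⟩
  exact ⟨Γ, hΓ0, isIntegralCurve_iff_isIntegralCurveAt.2 fun t ↦ hDΓ t (hD ▸ mem_univ t)⟩

/-- The flow of a locally Lipschitz vector field of linear growth on a Banach space is global and
consists of homeomorphisms. -/
theorem LocallyLipschitz.exists_flow [CompleteSpace E] (hV : LocallyLipschitz V) {C : ℝ}
    (hC : ∀ x, ‖V x‖ ≤ C * ‖x‖ + C) :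
    ∃ Φ : ℝ → E ≃ₜ E, ∀ x, Φ 0 x = x ∧ IsIntegralCurve (fun t ↦ Φ t x) (fun _ ↦ V) := by
  choose φ hφ0 hφ using hV.exists_integralCurve hC
  have hadd (s t : ℝ) (x : E) : φ (φ x s) t = φ x (t + s) := by
    have h := hV.integralCurve_unique (hφ (φ x s)) ((hφ x).comp_add s) (t₀ := 0)
      (by simp [hφ0])
    exact congrFun h t
  have hloc (p : E) : ∃ τ > 0, ∃ N ∈ 𝓝 p, ∀ x ∈ N, ∀ t ∈ Ioo (-τ) τ,
      ContinuousAt (fun y ↦ φ y t) x := by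
    obtain ⟨τ, hτ, N, hN, α, hα, hc⟩ := hV.exists_local_flow p
    refine ⟨τ, hτ, interior N, interior_mem_nhds.2 hN, fun x hx t ht ↦ ?_⟩
    have hc' : ContinuousOn (fun y ↦ α (y, t)) N :=
      hc.comp (by fun_prop) fun y hy ↦ ⟨hy, ht⟩
    refine (hc'.continuousAt (mem_interior_iff_mem_nhds.1 hx)).congr ?_
    filter_upwards [mem_interior_iff_mem_nhds.1 hx] with y hy
    exact hV.integralCurve_eqOn isPreconnected_Ioo (hα y hy).2
      (fun s _ ↦ (hφ y).isIntegralCurveAt s) (t₀ := 0) (by simpa using hτ)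
      ((hα y hy).1.trans (hφ0 y).symm) ht
  have hcont (t : ℝ) : Continuous (fun x ↦ φ x t) := by
    refine continuous_iff_continuousAt.2 fun x ↦ ?_
    refine (PreconnectedSpace.induction₂'
      (fun s t : ℝ ↦ ContinuousAt (fun x ↦ φ x s) x → ContinuousAt (fun x ↦ φ x t) x)
      (fun s ↦ ?_) ⟨fun _ _ _ h₁ h₂ ↦ h₂ ∘ h₁⟩ 0 t) ?_
    · obtain ⟨τ, hτ, N, hN, h⟩ := hloc (φ x s)
      have step {a b : ℝ} (ha : φ x a ∈ N) (hab : b - a ∈ Ioo (-τ) τ)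
          (hca : ContinuousAt (fun x ↦ φ x a) x) : ContinuousAt (fun x ↦ φ x b) x := by
        have := ContinuousAt.comp (g := fun y ↦ φ y (b - a)) (f := fun x ↦ φ x a)
          (h _ ha _ hab) hca
        simpa [Function.comp_def, hadd] using this
      filter_upwards [(hφ x).continuous.continuousAt.eventually_mem hN,
        Metric.ball_mem_nhds s hτ] with t htN hts
      rw [Metric.mem_ball, Real.dist_eq, abs_lt] at hts
      exact ⟨step (mem_of_mem_nhds hN) hts,
        step htN ⟨by linarith [hts.2], by linarith [hts.1]⟩⟩
    · simpa only [hφ0] using! continuousAt_id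
  refine ⟨fun t ↦ ⟨⟨fun x ↦ φ x t, fun x ↦ φ x (-t), fun x ↦ ?_, fun x ↦ ?_⟩, hcont t,
    hcont (-t)⟩, fun x ↦ ⟨hφ0 x, hφ x⟩⟩
  · simp [hadd, hφ0]
  · simp [hadd, hφ0]

end Flow

section Selection

open Set
open scoped Topology

variable {X E : Type*} [PseudoMetricSpace X] [NormedAddCommGroup E] [NormedSpace ℝ E]

lemma LocallyLipschitz.of_eventuallyEq {Y : Type*} [PseudoMetricSpace Y] {f : X → Y}
    (h : ∀ x, ∃ g, LocallyLipschitz g ∧ f =ᶠ[𝓝 x] g) : LocallyLipschitz f := by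
  intro x
  obtain ⟨g, hg, hfg⟩ := h x
  obtain ⟨K, s, hs, hK⟩ := hg x
  refine ⟨K, s ∩ {y | f y = g y}, inter_mem hs hfg, fun y hy z hz ↦ ?_⟩
  rw [hy.2, hz.2]
  exact hK hy.1 hz.1

lemma LocallyLipschitz.smul {f : X → ℝ} {g : X → E} (hf : LocallyLipschitz f)
    (hg : LocallyLipschitz g) : LocallyLipschitz fun x ↦ f x • g x :=
  (contDiff_smul (𝕜 := ℝ) (F := E)).locallyLipschitz.comp (hf.prodMk hg)

lemma LocallyLipschitz.inv_of_ne_zero {f : X → ℝ} (hf : LocallyLipschitz f) (h : ∀ x, f x ≠ 0) :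
    LocallyLipschitz fun x ↦ (f x)⁻¹ := by
  intro x
  obtain ⟨K, s, hs, hK⟩ := hf x
  obtain ⟨K', s', hs', hK'⟩ := (contDiffAt_inv ℝ (h x)).exists_lipschitzOnWith
  exact ⟨K' * K, s ∩ f ⁻¹' s', inter_mem hs (hf.continuous.continuousAt hs'),
    hK'.comp (hK.mono inter_subset_left) fun y hy ↦ hy.2⟩

lemma LocallyLipschitz.finsum {ι F : Type*} [SeminormedAddCommGroup F] {f : ι → X → F}
    (hf : ∀ i, LocallyLipschitz (f i)) (hfin : LocallyFinite fun i ↦ Function.support (f i)) :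
    LocallyLipschitz fun x ↦ ∑ᶠ i, f i x := by
  classical
  refine .of_eventuallyEq fun x ↦ ?_
  obtain ⟨s, hs⟩ := finsum_eventually_eq_sum hfin x
  refine ⟨fun y ↦ ∑ i ∈ s, f i y, ?_, hs⟩
  clear hs
  induction s using Finset.induction_on with
  | empty => simpa using LocallyLipschitz.const (0 : F)
  | insert i s hi ih => simpa [Finset.sum_insert hi] using (hf i).add ih

lemma IsOpen.exists_lipschitzWith_support_eq {U : Set X} (hU : IsOpen U) :
    ∃ ρ : X → ℝ, LipschitzWith 1 ρ ∧ (∀ x, 0 ≤ ρ x) ∧ Function.support ρ = U := by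
  rcases eq_empty_or_nonempty Uᶜ with h | h
  · refine ⟨fun _ ↦ 1, LipschitzWith.const' 1, fun _ ↦ zero_le_one, ?_⟩
    rw [compl_empty_iff.1 h]
    ext
    simp
  · refine ⟨fun x ↦ Metric.infDist x Uᶜ, Metric.lipschitz_infDist_pt _,
      fun _ ↦ Metric.infDist_nonneg, ?_⟩
    ext x
    rw [Function.mem_support, not_iff_comm, ← mem_compl_iff,
      hU.isClosed_compl.mem_iff_infDist_zero h]

/-- A convex-valued map which locally has constant selections has a locally Lipschitz selection. -/
theorem exists_locallyLipschitz_forall_mem_convex_of_local {t : X → Set E}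
    (ht : ∀ x, Convex ℝ (t x)) (H : ∀ x, ∃ w, ∀ᶠ y in 𝓝 x, w ∈ t y) :
    ∃ g : X → E, LocallyLipschitz g ∧ ∀ x, g x ∈ t x := by
  choose w hw using H
  obtain ⟨U, hUo, hUc, hUf, hUs⟩ := precise_refinement (fun x ↦ interior {y | w x ∈ t y})
    (fun x ↦ isOpen_interior)
    (iUnion_eq_univ_iff.2 fun x ↦ ⟨x, mem_interior_iff_mem_nhds.2 (hw x)⟩)
  choose ρ hρl hρ0 hρs using fun x ↦ (hUo x).exists_lipschitzWith_support_eq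
  have hρf : LocallyFinite fun x ↦ Function.support (ρ x) := by simpa only [hρs] using hUf
  have hσl : LocallyLipschitz fun y ↦ ∑ᶠ x, ρ x y :=
    .finsum (fun x ↦ (hρl x).locallyLipschitz) hρf
  have hσ (y : X) : 0 < ∑ᶠ x, ρ x y := by
    obtain ⟨x, hx⟩ := iUnion_eq_univ_iff.1 hUc y
    have h1 : ρ x y ≠ 0 := by rwa [← Function.mem_support, hρs]
    exact (lt_of_le_of_ne (hρ0 x y) h1.symm).trans_le
      (single_le_finsum x (hρf.point_finite y) fun z ↦ hρ0 z y)
  have hWl : LocallyLipschitz fun y ↦ ∑ᶠ x, ρ x y • w x :=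
    .finsum (fun x ↦ (hρl x).locallyLipschitz.smul (.const (w x)))
      (hρf.subset fun x y hy ↦ left_ne_zero_of_smul hy)
  refine ⟨_, (hσl.inv_of_ne_zero fun y ↦ (hσ y).ne').smul hWl, fun y ↦ ?_⟩
  simp only [smul_finsum, smul_smul]
  refine (ht y).finsum_mem (fun x ↦ mul_nonneg (inv_nonneg.2 (hσ y).le) (hρ0 x y)) ?_
    fun x hx ↦ ?_
  · rw [← mul_finsum, inv_mul_cancel₀ (hσ y).ne']
  · have : y ∈ U x := by
      rw [← hρs]
      exact right_ne_zero_of_mul hx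
    exact interior_subset (s := {y | w x ∈ t y}) (hUs x this)

end Selection

section PseudoGradient

open Set
open scoped Topology

variable {X W : Type*} [NormedAddCommGroup X] [NormedSpace ℝ X]
  [NormedAddCommGroup W] [NormedSpace ℝ W]

lemma WCPS.exists_le_norm_fderiv_mul {ι : X →L[ℝ] W} {J : X → ℝ} {c : ℝ} (hJ : WCPS ι J c)
    (hK : ∀ u : X, ¬ (J u = c ∧ fderiv ℝ J u = 0)) :
    ∃ δ > 0, ∀ u, |J u - c| < δ → δ ≤ ‖fderiv ℝ J u‖ * (1 + ‖u‖) := by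
  by_contra! h
  choose u hu1 hu2 using fun n : ℕ ↦ h (1 / ((n : ℝ) + 1)) (by positivity)
  have hlim := tendsto_one_div_add_atTop_nhds_zero_nat (𝕜 := ℝ)
  have hseq : IsCPSSeq J c u := by
    constructor
    · rw [tendsto_iff_dist_tendsto_zero]
      exact squeeze_zero (fun _ ↦ dist_nonneg) (fun n ↦ (hu1 n).le) hlim
    · exact squeeze_zero (fun _ ↦ by positivity) (fun n ↦ (hu2 n).le) hlim
  obtain ⟨v, -, -, -, hv⟩ := hJ u hseq
  exact hK v hv

lemma exists_norm_le_one_half_norm_le_apply (f : X →L[ℝ] ℝ) :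
    ∃ h : X, ‖h‖ ≤ 1 ∧ ‖f‖ / 2 ≤ f h := by
  rcases (norm_nonneg f).eq_or_lt with hf | hf
  · exact ⟨0, by simp, by simp [← hf]⟩
  · obtain ⟨h, h1, h2⟩ := f.exists_lt_apply_of_lt_opNorm (half_lt_self hf)
    rcases le_total 0 (f h) with h0 | h0
    · exact ⟨h, h1.le, by rw [Real.norm_of_nonneg h0] at h2; exact h2.le⟩
    · refine ⟨-h, by simpa using h1.le, ?_⟩
      rw [Real.norm_of_nonpos h0] at h2
      simpa using h2.le

/-- A locally Lipschitz pseudo-gradient field of linear growth, odd if `J` is even. -/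
lemma exists_locallyLipschitz_pseudogradient {J : X → ℝ} (hJ : ContDiff ℝ 1 J) {c δ r : ℝ}
    (hδ : 0 < δ) (hr : r < δ)
    (h : ∀ u, |J u - c| < δ → δ ≤ ‖fderiv ℝ J u‖ * (1 + ‖u‖)) :
    ∃ v : X → X, LocallyLipschitz v ∧ (∀ u, ‖v u‖ ≤ 2 * (1 + ‖u‖)) ∧
      (∀ u, |J u - c| ≤ r → δ / 4 ≤ fderiv ℝ J u (v u)) ∧
      ((∀ u, J (-u) = J u) → ∀ u, v (-u) = -v u) := by
  have hJc := hJ.continuous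
  have hdJ := hJ.continuous_fderiv one_ne_zero
  obtain ⟨v, hvl, hv⟩ := exists_locallyLipschitz_forall_mem_convex_of_local
    (t := fun u : X ↦ {w : X | ‖w‖ ≤ 2 * (1 + ‖u‖) ∧ (|J u - c| ≤ r → δ / 4 ≤ fderiv ℝ J u w)})
    (fun u ↦ by
      rintro w ⟨hw1, hw2⟩ z ⟨hz1, hz2⟩ a b ha hb hab
      refine ⟨?_, fun hu ↦ ?_⟩
      · simpa using convex_closedBall (0 : X) (2 * (1 + ‖u‖)) (by simpa using hw1)
          (by simpa using hz1) ha hb hab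
      · simpa using convex_Ici (δ / 4) (hw2 hu) (hz2 hu) ha hb hab)
    (fun x ↦ by
      rcases lt_or_ge r |J x - c| with hx | hx
      · refine ⟨0, ?_⟩
        have : ∀ᶠ u in 𝓝 x, r < |J u - c| :=
          (by fun_prop : Continuous fun u ↦ |J u - c|).continuousAt.eventually_const_lt hx
        filter_upwards [this] with u hu
        exact ⟨by rw [norm_zero]; positivity, fun h ↦ absurd h hu.not_ge⟩
      · obtain ⟨e, he1, he2⟩ := exists_norm_le_one_half_norm_le_apply (fderiv ℝ J x)
        have hpos : 0 < 1 + ‖x‖ := by positivity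
        refine ⟨(1 + ‖x‖) • e, ?_⟩
        have hn : ‖(1 + ‖x‖) • e‖ < 2 * (1 + ‖x‖) := by
          rw [norm_smul, Real.norm_of_nonneg hpos.le]
          nlinarith
        have hd : δ / 4 < fderiv ℝ J x ((1 + ‖x‖) • e) := by
          rw [map_smul, smul_eq_mul]
          nlinarith [h x (hx.trans_lt hr)]
        have h1 : ∀ᶠ u in 𝓝 x, ‖(1 + ‖x‖) • e‖ < 2 * (1 + ‖u‖) :=
          (by fun_prop : Continuous fun u : X ↦ 2 * (1 + ‖u‖)).continuousAt.eventually_const_lt hn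
        have h2 : ∀ᶠ u in 𝓝 x, δ / 4 < fderiv ℝ J u ((1 + ‖x‖) • e) :=
          (by fun_prop : Continuous fun u : X ↦
            fderiv ℝ J u ((1 + ‖x‖) • e)).continuousAt.eventually_const_lt hd
        filter_upwards [h1, h2] with u hu1 hu2
        exact ⟨hu1.le, fun _ ↦ hu2.le⟩)
  by_cases heven : ∀ u, J (-u) = J u
  · have hdneg (u : X) : fderiv ℝ J (-u) = -fderiv ℝ J u := by
      have h1 := (hJ.differentiable one_ne_zero u).hasFDerivAt.congr_of_eventuallyEq
        (.of_forall heven)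
      have h2 : HasFDerivAt J (fderiv ℝ J (-u)) (-u) :=
        (hJ.differentiable one_ne_zero (-u)).hasFDerivAt
      simpa [neg_eq_iff_eq_neg] using (h2.comp u (hasFDerivAt_id u).neg).unique h1
    refine ⟨fun u ↦ (2⁻¹ : ℝ) • (v u - v (-u)), ?_, fun u ↦ ?_, fun u hu ↦ ?_, fun _ u ↦ ?_⟩
    · exact (LocallyLipschitz.const (2⁻¹ : ℝ)).smul
        (hvl.sub (hvl.comp LocallyLipschitz.id.neg))
    · have h1 := (hv u).1
      have h2 := (hv (-u)).1
      rw [norm_neg] at h2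
      rw [norm_smul, Real.norm_of_nonneg (by norm_num)]
      linarith [norm_sub_le (v u) (v (-u))]
    · have h1 := (hv u).2 hu
      have h2 := (hv (-u)).2 (by rwa [heven])
      rw [hdneg, neg_apply] at h2
      rw [map_smul, map_sub, smul_eq_mul]
      linarith
    · simp only [neg_neg, ← smul_neg, neg_sub]
  · exact ⟨v, hvl, fun u ↦ (hv u).1, fun u ↦ (hv u).2, fun h ↦ absurd h heven⟩

end PseudoGradient

/-- Deformation Lemma: if `J ∈ C¹(X,ℝ)` satisfies the `(wCPS)_c` condition and has no
critical points at level `c`, then for every `ε̄ > 0` there exist `ε > 0` with `2ε < ε̄`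
and a homeomorphism `ψ : X → X` mapping `J^{c+ε}` into `J^{c-ε}` and fixing the points
where `J ≤ c - ε̄` or `J ≥ c + ε̄`; if `J` is even, `ψ` can be chosen odd. -/
theorem deformation_lemma {X W : Type*}
    [NormedAddCommGroup X] [NormedSpace ℝ X] [CompleteSpace X]
    [NormedAddCommGroup W] [NormedSpace ℝ W] [CompleteSpace W]
    (ι : X →L[ℝ] W) (hι : Function.Injective ι)
    (J : X → ℝ) (hJ : ContDiff ℝ 1 J) (c : ℝ)
    (hwCPS : WCPS ι J c)
    (hK : ∀ u : X, ¬ (J u = c ∧ fderiv ℝ J u = 0)) :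
    ∀ εbar : ℝ, 0 < εbar → ∃ ε : ℝ, 0 < ε ∧ 2 * ε < εbar ∧
      ∃ ψ : X ≃ₜ X,
        (∀ u : X, J u ≤ c + ε → J (ψ u) ≤ c - ε) ∧
        (∀ u : X, (J u ≤ c - εbar ∨ c + εbar ≤ J u) → ψ u = u) ∧
        ((∀ u : X, J (-u) = J u) → ∀ u : X, ψ (-u) = -ψ u) := by
  intro εbar hεbar
  obtain ⟨δ, hδ, h⟩ := hwCPS.exists_le_norm_fderiv_mul hK
  set ε : ℝ := min δ εbar / 3
  have hm : 0 < min δ εbar := lt_min hδ hεbar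
  have hε : 0 < ε := by positivity
  have hεδ : 2 * ε < δ := by
    simp only [ε]; linarith [min_le_left δ εbar]
  have hεbar' : 2 * ε < εbar := by
    simp only [ε]; linarith [min_le_right δ εbar]
  obtain ⟨v, hvl, hvn, hvd, hvodd⟩ :=
    exists_locallyLipschitz_pseudogradient hJ hδ hεδ h
  let χ : X → ℝ := fun u ↦ max 0 (min 1 (2 - ε⁻¹ * |J u - c|))
  have hχl : LocallyLipschitz χ := by
    have habs : LocallyLipschitz fun u ↦ |J u - c| :=
      lipschitzWith_one_norm.locallyLipschitz.comp (hJ.locallyLipschitz.sub (.const c))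
    exact (((LocallyLipschitz.const 2).sub
      ((LocallyLipschitz.const ε⁻¹).smul habs)).const_min 1).const_max 0
  have hχ0 (u : X) : 0 ≤ χ u := le_max_left _ _
  have hχ1 (u : X) : χ u ≤ 1 := max_le zero_le_one (min_le_left _ _)
  have hχout (u : X) (hu : 2 * ε ≤ |J u - c|) : χ u = 0 := by
    have : 2 ≤ ε⁻¹ * |J u - c| := by
      rw [inv_mul_eq_div, le_div_iff₀ hε]; exact hu
    exact max_eq_left ((min_le_right _ _).trans (by linarith))
  have hχin (u : X) (hu : |J u - c| ≤ ε) : χ u = 1 := by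
    have : ε⁻¹ * |J u - c| ≤ 1 := by
      rw [inv_mul_eq_div, div_le_one hε]; exact hu
    simp only [χ]
    rw [min_eq_left (by linarith), max_eq_right zero_le_one]
  let V : X → X := fun u ↦ -(χ u • v u)
  have hVl : LocallyLipschitz V := (hχl.smul hvl).neg
  have hVn (u : X) : ‖V u‖ ≤ 2 * ‖u‖ + 2 := by
    simp only [V, norm_neg, norm_smul, Real.norm_of_nonneg (hχ0 u)]
    nlinarith [hvn u, hχ1 u, norm_nonneg (v u)]
  have hVJ (u : X) : fderiv ℝ J u (V u) ≤ 0 := by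
    simp only [V, map_neg, map_smul, smul_eq_mul, neg_nonpos]
    rcases le_total (2 * ε) |J u - c| with hu | hu
    · rw [hχout u hu, zero_mul]
    · exact mul_nonneg (hχ0 u) (by linarith [hvd u hu])
  have hVJ' (u : X) (hu : |J u - c| ≤ ε) : fderiv ℝ J u (V u) ≤ -(δ / 4) := by
    simp only [V, map_neg, hχin u hu, one_smul, neg_le_neg_iff]
    exact hvd u (by linarith)
  obtain ⟨Φ, hΦ⟩ := hVl.exists_flow hVn
  have hder (u : X) (t : ℝ) : HasDerivAt (fun s ↦ J (Φ s u)) (fderiv ℝ J (Φ t u) (V (Φ t u))) t :=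
    (hJ.differentiable one_ne_zero _).hasFDerivAt.comp_hasDerivAt t ((hΦ u).2 t)
  have hanti (u : X) : Antitone fun t ↦ J (Φ t u) :=
    antitone_of_hasDerivAt_nonpos (hder u) fun t ↦ hVJ _
  set T : ℝ := 8 * ε / δ
  have hT : 0 ≤ T := by positivity
  refine ⟨ε, hε, hεbar', Φ T, fun u hu ↦ ?_, fun u hu ↦ ?_, fun heven u ↦ ?_⟩
  · by_contra! hlt
    have hmem (t : ℝ) (ht : t ∈ Set.Icc 0 T) : |J (Φ t u) - c| ≤ ε := by
      have h1 : J (Φ t u) ≤ J (Φ 0 u) := hanti u ht.1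
      have h2 : J (Φ T u) ≤ J (Φ t u) := hanti u ht.2
      rw [(hΦ u).1] at h1
      exact abs_le.2 ⟨by linarith, by linarith⟩
    have := (convex_Icc 0 T).image_sub_le_mul_sub_of_deriv_le (f := fun t ↦ J (Φ t u))
      (fun t _ ↦ (hder u t).continuousAt.continuousWithinAt)
      (fun t _ ↦ (hder u t).differentiableAt.differentiableWithinAt)
      (C := -(δ / 4)) (fun t ht ↦ by
        rw [(hder u t).deriv]
        exact hVJ' _ (hmem t (interior_subset ht)))
      0 (Set.left_mem_Icc.2 hT) T (Set.right_mem_Icc.2 hT) hT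
    have hδT : δ / 4 * T = 2 * ε := by simp only [T]; field_simp; norm_num
    simp only [(hΦ u).1] at this
    linarith
  · have hV0 : V u = 0 := by
      have : 2 * ε ≤ |J u - c| := by
        rcases hu with hu | hu
        · linarith [neg_le_abs (J u - c)]
        · linarith [le_abs_self (J u - c)]
      simp only [V, hχout u this, zero_smul, neg_zero]
    exact congrFun (hVl.integralCurve_unique (hΦ u).2
      (isIntegralCurve_const fun _ ↦ hV0) (t₀ := 0) (hΦ u).1) T
  · have hVodd (u : X) : V (-u) = -V u := by
      simp only [V, χ, heven, hvodd heven, smul_neg]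
    refine congrFun (hVl.integralCurve_unique (γ := fun t ↦ Φ t (-u)) (η := fun t ↦ -Φ t u)
      (hΦ (-u)).2 (fun t ↦ ?_) (t₀ := 0) ?_) T
    · change HasDerivAt _ (V (-Φ t u)) t
      rw [hVodd]
      exact ((hΦ u).2 t).neg
    · simp only [(hΦ _).1]
end

section
/- Let (X,‖·‖_X) be a real Banach space continuously embedded in a real Banach space (W,‖·‖_W) and let J : X → ℝ be continuously Fréchet differentiable with J(0) = 0. Assume that J satisfies the (wCPS)_c condition at every level c ∈ ℝ and that there exist constants r_0, ϱ_0 > 0 and a point e ∈ X such that: (i) J(u) ≥ ϱ_0 for every u ∈ X with ‖u‖_W = r_0; (ii) ‖e‖_W > r_0 and J(e) < ϱ_0. Then J has a critical point u* ∈ X, i.e. dJ(u*) = 0, with J(u*) ≥ ϱ_0. -/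
open Filter

open Topology Set

/-- A weak form of Ekeland's variational principle. -/
theorem LowerSemicontinuous.exists_forall_le_add_mul_dist {α : Type*} [MetricSpace α]
    {S : Set α} (hS : IsComplete S) {f : α → ℝ} (hf : LowerSemicontinuous f)
    {m : ℝ} (hm : ∀ x ∈ S, m ≤ f x) {l : ℝ} (hl : 0 < l) {x₀ : α} (hx₀ : x₀ ∈ S) :
    ∃ x ∈ S, f x ≤ f x₀ ∧ ∀ y ∈ S, f x ≤ f y + l * dist x y := by
  let T : α → Set α := fun x => {y | y ∈ S ∧ f y + l * dist x y ≤ f x}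
  have self_mem : ∀ {x}, x ∈ S → x ∈ T x := fun {x} hx => ⟨hx, by simp⟩
  have trans_mem : ∀ {x y z}, y ∈ T x → z ∈ T y → z ∈ T x := by
    rintro x y z ⟨-, hy⟩ ⟨hz, hzy⟩
    refine ⟨hz, ?_⟩
    nlinarith [dist_triangle x y z]
  have step : ∀ (n : ℕ) (x : S), ∃ y : S, (y : α) ∈ T x ∧
      ∀ z ∈ T x, f y ≤ f z + (1 / 2 : ℝ) ^ n := by
    rintro n ⟨x, hx⟩
    have hne : (f '' T x).Nonempty := ⟨_, mem_image_of_mem f (self_mem hx)⟩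
    have hbd : BddBelow (f '' T x) := ⟨m, by rintro _ ⟨y, hy, rfl⟩; exact hm y hy.1⟩
    obtain ⟨_, ⟨y, hy, rfl⟩, hlt⟩ := exists_lt_of_csInf_lt hne
      (lt_add_of_pos_right (sInf (f '' T x)) (by positivity : (0 : ℝ) < (1 / 2) ^ n))
    refine ⟨⟨y, hy.1⟩, hy, fun z hz => ?_⟩
    have := csInf_le hbd (mem_image_of_mem f hz)
    simp only
    linarith
  choose g hgT hgle using step
  obtain ⟨u, hu₀, hu⟩ : ∃ u : ℕ → S, u 0 = ⟨x₀, hx₀⟩ ∧ ∀ n, u (n + 1) = g n (u n) :=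
    ⟨fun n => Nat.rec ⟨x₀, hx₀⟩ g n, rfl, fun n => rfl⟩
  have hmem : ∀ n k : ℕ, (u (n + k) : α) ∈ T (u n) := by
    intro n k
    induction k with
    | zero => exact self_mem (u n).2
    | succ k ih => exact trans_mem ih (by rw [← add_assoc, hu]; exact hgT _ _)
  have hanti : Antitone fun n => f (u n) := antitone_nat_of_succ_le fun n => by
    have := (hmem n 1).2
    nlinarith [dist_nonneg (x := (u n : α)) (y := u (n + 1))]
  have hbdd : BddBelow (range fun n => f (u n)) := ⟨m, by rintro _ ⟨n, rfl⟩; exact hm _ (u n).2⟩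
  set L := ⨅ n, f (u n)
  have hL : Tendsto (fun n => f (u n)) atTop (𝓝 L) := tendsto_atTop_ciInf hanti hbdd
  have hcauchy : CauchySeq fun n => (u n : α) := by
    refine cauchySeq_of_le_tendsto_0' (fun n => (f (u n) - L) / l) (fun n k hnk => ?_) ?_
    · obtain ⟨k, rfl⟩ := Nat.exists_eq_add_of_le hnk
      rw [le_div_iff₀ hl]
      have h₁ := (hmem n k).2
      have h₂ : L ≤ f (u (n + k)) := ciInf_le hbdd (n + k)
      linarith
    · simpa using (hL.sub_const L).div_const l
  obtain ⟨x, hxS, hux⟩ := cauchySeq_tendsto_of_isComplete hS (fun n => (u n).2) hcauchy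
  have hxT : ∀ n, x ∈ T (u n) := by
    intro n
    refine ⟨hxS, ?_⟩
    have hlsc : LowerSemicontinuous fun y => f y + l * dist (u n : α) y :=
      hf.add (by fun_prop : Continuous fun y => l * dist (u n : α) y).lowerSemicontinuous
    refine (hlsc.isClosed_preimage (f (u n))).mem_of_tendsto hux ?_
    filter_upwards [eventually_ge_atTop n] with k hk
    obtain ⟨k, rfl⟩ := Nat.exists_eq_add_of_le hk
    exact (hmem n k).2
  refine ⟨x, hxS, ?_, fun y hy => ?_⟩
  · have := (hxT 0).2
    rw [hu₀] at this
    nlinarith [dist_nonneg (x := x₀) (y := x)]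
  · by_contra! hlt
    have hyT : y ∈ T x := ⟨hy, hlt.le⟩
    have hle : ∀ n, f x ≤ f y + (1 / 2 : ℝ) ^ n := fun n => by
      have h₁ := hgle n (u n) y (trans_mem (hxT n) hyT)
      have h₂ := (hxT (n + 1)).2
      rw [hu] at h₂
      nlinarith [dist_nonneg (x := (g n (u n) : α)) (y := x)]
    have hlim : Tendsto (fun n : ℕ => f y + (1 / 2 : ℝ) ^ n) atTop (𝓝 (f y + 0)) :=
      (tendsto_pow_atTop_nhds_zero_of_lt_one (by norm_num) (by norm_num)).const_add _
    have := ge_of_tendsto' hlim hle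
    nlinarith [dist_nonneg (x := x) (y := y)]

section CeramiEmbedding

variable {X : Type*} [NormedAddCommGroup X] [NormedSpace ℝ X]

/-- An embedding of `X` into `ℝ × X` inducing a complete metric on `X` which at `x` is comparable
to the norm divided by `1 + ‖x‖`. -/
noncomputable def ceramiEmbedding (x : X) : ℝ × X :=
  (Real.log (1 + ‖x‖), (1 + ‖x‖)⁻¹ • x)

/-- A continuous left inverse of `ceramiEmbedding`. -/
noncomputable def ceramiRetraction (p : ℝ × X) : X :=
  Real.exp p.1 • p.2

theorem ceramiRetraction_ceramiEmbedding (x : X) :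
    ceramiRetraction (ceramiEmbedding x) = x := by
  have h : 0 < 1 + ‖x‖ := by positivity
  simp [ceramiRetraction, ceramiEmbedding, Real.exp_log h, smul_smul, h.ne']

theorem continuous_ceramiEmbedding : Continuous (ceramiEmbedding : X → ℝ × X) := by
  have h : ∀ x : X, 1 + ‖x‖ ≠ 0 := fun x => by positivity
  unfold ceramiEmbedding
  fun_prop (disch := exact h _)

theorem continuous_ceramiRetraction : Continuous (ceramiRetraction : ℝ × X → X) := by
  unfold ceramiRetraction
  fun_prop

theorem dist_ceramiEmbedding_le {x y : X} {h : ℝ} (h2 : h ≤ 1 / 2)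
    (hxy : ‖x - y‖ ≤ h * (1 + ‖x‖)) :
    dist (ceramiEmbedding x) (ceramiEmbedding y) ≤ 2 * h := by
  have hn : |(1 + ‖x‖) - (1 + ‖y‖)| ≤ h * (1 + ‖x‖) := by
    rw [add_sub_add_left_eq_sub]
    exact (abs_norm_sub_norm_le x y).trans hxy
  have ha : 0 < 1 + ‖x‖ := by positivity
  have hb : 0 < 1 + ‖y‖ := by positivity
  have h0 : 0 ≤ h := nonneg_of_mul_nonneg_left ((norm_nonneg _).trans hxy) ha
  have hyb : ‖y‖ ≤ 1 + ‖y‖ := by linarith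
  rw [dist_eq_norm]
  simp only [ceramiEmbedding, Prod.mk_sub_mk]
  generalize 1 + ‖x‖ = a at *
  generalize 1 + ‖y‖ = b at *
  obtain ⟨hn₁, hn₂⟩ := abs_le.1 hn
  rw [Prod.norm_mk, max_le_iff]
  constructor
  · rw [Real.norm_eq_abs, abs_le]
    have h₁ := Real.log_le_sub_one_of_pos (div_pos ha hb)
    have h₂ := Real.log_le_sub_one_of_pos (div_pos hb ha)
    rw [Real.log_div ha.ne' hb.ne'] at h₁
    rw [Real.log_div hb.ne' ha.ne'] at h₂
    have h₃ : a / b ≤ 1 + 2 * h := by rw [div_le_iff₀ hb]; nlinarith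
    have h₄ : b / a ≤ 1 + h := by rw [div_le_iff₀ ha]; linarith
    constructor <;> linarith
  · have e : a⁻¹ • x - b⁻¹ • y = a⁻¹ • (x - y) + (a⁻¹ - b⁻¹) • y := by module
    have h₁ : ‖a⁻¹ • (x - y)‖ ≤ h := by
      rw [norm_smul, Real.norm_of_nonneg (by positivity), inv_mul_le_iff₀ ha]
      linarith
    have h₂ : ‖(a⁻¹ - b⁻¹) • y‖ ≤ h := by
      rw [norm_smul, Real.norm_eq_abs, inv_sub_inv ha.ne' hb.ne', abs_div, abs_mul,
        abs_of_pos ha, abs_of_pos hb, abs_sub_comm]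
      calc |a - b| / (a * b) * ‖y‖ ≤ h * a / (a * b) * b := by gcongr
        _ = h := by field_simp
    rw [e]
    exact (norm_add_le _ _).trans (by linarith)

end CeramiEmbedding

section MinMax

variable {X : Type*} [NormedAddCommGroup X] [NormedSpace ℝ X] {J : X → ℝ}

/-- If the weighted derivative of `J` is bounded below along the set where `J` is maximal on the
path `γ`, then a small deformation of `γ` fixing the endpoints lowers its maximum at a definite
rate. -/
theorem exists_deformation_of_le_norm_fderiv (hJ : ContDiff ℝ 1 J) (γ : C(unitInterval, X))
    {M ε : ℝ} (hε : 0 < ε) (hM : ∀ t, J (γ t) ≤ M) (h₀ : J (γ 0) < M) (h₁ : J (γ 1) < M)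
    (hd : ∀ t, J (γ t) = M → ε ≤ ‖fderiv ℝ J (γ t)‖ * (1 + ‖γ t‖)) :
    ∃ h : ℝ, 0 < h ∧ h ≤ 1 / 2 ∧ ∃ η : C(unitInterval, X), η 0 = γ 0 ∧ η 1 = γ 1 ∧
      (∀ t, ‖γ t - η t‖ ≤ h * (1 + ‖γ t‖)) ∧ ∀ t, J (η t) ≤ M - h * (ε / 4) := by
  have hJc : Continuous J := hJ.continuous
  have hdc : Continuous fun t => fderiv ℝ J (γ t) :=
    (hJ.continuous_fderiv (by norm_num)).comp γ.continuous
  have hJγ : Continuous fun t => J (γ t) := hJc.comp γ.continuous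
  have hopen : IsOpen {t | J (γ t) < M} := isOpen_lt hJγ continuous_const
  have field : ∃ v : C(unitInterval, X), ∀ t, v t ∈ {w : X | ‖w‖ ≤ 1 + ‖γ t‖ ∧
      (J (γ t) = M → ε / 2 < fderiv ℝ J (γ t) w) ∧ (t = 0 ∨ t = 1 → w = 0)} := by
    refine exists_continuous_forall_mem_convex_of_local_const (fun t => ?_) (fun t => ?_)
    · rintro w ⟨hw₁, hw₂, hw₃⟩ z ⟨hz₁, hz₂, hz₃⟩ a b ha hb hab
      refine ⟨?_, fun h => ?_, fun h => by simp [hw₃ h, hz₃ h]⟩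
      · simpa using convex_closedBall (0 : X) (1 + ‖γ t‖) (by simpa using hw₁)
          (by simpa using hz₁) ha hb hab
      · exact convex_halfSpace_gt (fderiv ℝ J (γ t)).toLinearMap.isLinear (ε / 2)
          (hw₂ h) (hz₂ h) ha hb hab
    · rcases (hM t).lt_or_eq with hlt | heq
      · refine ⟨0, ?_⟩
        filter_upwards [hopen.mem_nhds hlt] with s hs
        exact ⟨by simpa using by positivity, fun h => absurd h (ne_of_lt hs), fun _ => rfl⟩
      · have hpos : 0 < 1 + ‖γ t‖ := by positivity
        obtain ⟨w, hw, hwd⟩ : ∃ w : X, ‖w‖ < 1 + ‖γ t‖ ∧ ε / 2 < fderiv ℝ J (γ t) w := by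
          have hlt : ε / 2 / (1 + ‖γ t‖) < ‖fderiv ℝ J (γ t)‖ := by
            rw [div_lt_iff₀ hpos]
            linarith [hd t heq]
          obtain ⟨x, hx, hxd⟩ :=
            ContinuousLinearMap.exists_lt_apply_of_lt_opNorm (fderiv ℝ J (γ t)) hlt
          rw [div_lt_iff₀ hpos, Real.norm_eq_abs] at hxd
          rcases abs_cases (fderiv ℝ J (γ t) x) with ⟨h, -⟩ | ⟨h, -⟩
          · refine ⟨(1 + ‖γ t‖) • x, ?_, ?_⟩
            · rw [norm_smul, Real.norm_of_nonneg hpos.le]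
              nlinarith
            · rw [map_smul, smul_eq_mul, ← h]
              linarith
          · refine ⟨-((1 + ‖γ t‖) • x), ?_, ?_⟩
            · rw [norm_neg, norm_smul, Real.norm_of_nonneg hpos.le]
              nlinarith
            · rw [map_neg, map_smul, smul_eq_mul]
              rw [h] at hxd
              linarith
        refine ⟨w, ?_⟩
        have hc₁ : Continuous fun s => 1 + ‖γ s‖ := by fun_prop
        have hc₂ : Continuous fun s => fderiv ℝ J (γ s) w := hdc.clm_apply continuous_const
        have ht₀ : t ≠ 0 := by rintro rfl; exact h₀.ne heq
        have ht₁ : t ≠ 1 := by rintro rfl; exact h₁.ne heq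
        filter_upwards [hc₁.continuousAt.eventually_const_lt hw,
          hc₂.continuousAt.eventually_const_lt hwd, eventually_ne_nhds ht₀,
          eventually_ne_nhds ht₁] with s hs₁ hs₂ hs₃ hs₄
        exact ⟨hs₁.le, fun _ => hs₂, fun h => (h.elim hs₃ hs₄).elim⟩
  obtain ⟨v, hv⟩ := field
  have key : ∀ᶠ h in 𝓝 (0 : ℝ), ∀ t ∈ (univ : Set unitInterval),
      0 < h → J (γ t - h • v t) ≤ M - h * (ε / 4) := by
    refine isCompact_univ.eventually_forall_of_forall_eventually fun t _ => ?_
    have hcη : Continuous fun z : ℝ × unitInterval => γ z.2 - z.1 • v z.2 := by fun_prop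
    rcases (hM t).lt_or_eq with hlt | heq
    · have hc₁ : Continuous fun z : ℝ × unitInterval =>
          J (γ z.2 - z.1 • v z.2) + z.1 * (ε / 4) := (hJc.comp hcη).add (by fun_prop)
      filter_upwards [hc₁.continuousAt.eventually_lt_const
        (show J (γ t - (0 : ℝ) • v t) + 0 * (ε / 4) < M by simpa using hlt)] with z hz _
      linarith
    · set N := 1 + ‖v t‖
      have hN : 0 < N := by positivity
      have hstrict := (hJ.contDiffAt (x := γ t)).hasStrictFDerivAt (by norm_num)
      have hbound := hstrict.isLittleO.def (show 0 < ε / 4 / N by positivity)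
      have hpair : Tendsto (fun z : ℝ × unitInterval => (γ z.2 - z.1 • v z.2, γ z.2))
          (𝓝 (0, t)) (𝓝 (γ t, γ t)) := by
        have : Continuous fun z : ℝ × unitInterval => (γ z.2 - z.1 • v z.2, γ z.2) := by
          fun_prop
        simpa using this.tendsto ((0 : ℝ), t)
      have hc₁ : Continuous fun z : ℝ × unitInterval => ‖v z.2‖ := by fun_prop
      have hc₂ : Continuous fun z : ℝ × unitInterval => fderiv ℝ J (γ t) (v z.2) := by fun_prop
      filter_upwards [hpair.eventually hbound,
        hc₁.continuousAt.eventually_lt_const (show ‖v t‖ < N by simp [N]),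
        hc₂.continuousAt.eventually_const_lt ((hv t).2.1 heq)] with z hz₁ hz₂ hz₃ hpos
      simp only [sub_sub_cancel_left, map_neg, map_smul, smul_eq_mul, norm_neg, norm_smul,
        Real.norm_of_nonneg hpos.le] at hz₁
      have h₂ : ε / 4 / N * (z.1 * ‖v z.2‖) ≤ z.1 * (ε / 4) := by
        calc ε / 4 / N * (z.1 * ‖v z.2‖) ≤ ε / 4 / N * (z.1 * N) := by gcongr
          _ = z.1 * (ε / 4) := by field_simp
      have h₃ := (le_abs_self _).trans hz₁
      nlinarith [hM z.2]
  obtain ⟨h, ⟨hk, hh⟩, hpos⟩ := ((key.filter_mono nhdsWithin_le_nhds).and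
    ((eventually_le_nhds (show (0 : ℝ) < 1 / 2 by norm_num)).filter_mono
      nhdsWithin_le_nhds)).and (self_mem_nhdsWithin (s := Ioi (0 : ℝ))) |>.exists
  refine ⟨h, hpos, hh, γ - h • v, ?_, ?_, fun t => ?_, fun t => hk t (mem_univ t) hpos⟩
  · simp [(hv 0).2.2 (Or.inl rfl)]
  · simp [(hv 1).2.2 (Or.inr rfl)]
  · simp only [ContinuousMap.sub_apply, ContinuousMap.smul_apply, sub_sub_cancel, norm_smul,
      Real.norm_of_nonneg (mem_Ioi.1 hpos).le]
    exact mul_le_mul_of_nonneg_left (hv t).1 (mem_Ioi.1 hpos).le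

/-- The mountain pass level of a `C¹` function carries Cerami sequences. -/
theorem exists_isCPSSeq_of_forall_path [CompleteSpace X] (hJ : ContDiff ℝ 1 J) {x y : X} {b : ℝ}
    (hx : J x < b) (hy : J y < b)
    (hpath : ∀ γ : C(unitInterval, X), γ 0 = x → γ 1 = y → ∃ t, b ≤ J (γ t)) :
    ∃ c, b ≤ c ∧ ∃ u : ℕ → X, IsCPSSeq J c u := by
  let S : Set C(unitInterval, ℝ × X) := {g | (∀ t, ceramiEmbedding (ceramiRetraction (g t)) = g t) ∧
    ceramiRetraction (g 0) = x ∧ ceramiRetraction (g 1) = y}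
  let path : C(unitInterval, ℝ × X) → C(unitInterval, X) := fun g =>
    ⟨fun t => ceramiRetraction (g t), continuous_ceramiRetraction.comp g.continuous⟩
  let lift : C(unitInterval, X) → C(unitInterval, ℝ × X) := fun γ =>
    ⟨fun t => ceramiEmbedding (γ t), continuous_ceramiEmbedding.comp γ.continuous⟩
  have lift_mem : ∀ γ : C(unitInterval, X), γ 0 = x → γ 1 = y → lift γ ∈ S := fun γ h₀ h₁ =>
    ⟨fun t => by simp [lift, ceramiRetraction_ceramiEmbedding],
      by simp [lift, ceramiRetraction_ceramiEmbedding, h₀],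
      by simp [lift, ceramiRetraction_ceramiEmbedding, h₁]⟩
  have path_lift : ∀ γ, path (lift γ) = γ := fun γ => by
    ext t
    exact ceramiRetraction_ceramiEmbedding (γ t)
  have hSclosed : IsClosed S := by
    have hr := continuous_ceramiRetraction (X := X)
    have he := continuous_ceramiEmbedding (X := X)
    have hev : ∀ t, Continuous fun g : C(unitInterval, ℝ × X) => g t :=
      fun t => continuous_eval_const t
    have hfix : IsClosed {g : C(unitInterval, ℝ × X) |
        ∀ t, ceramiEmbedding (ceramiRetraction (g t)) = g t} := by
      rw [ofPred_forall]
      exact isClosed_iInter fun t => isClosed_eq (he.comp (hr.comp (hev t))) (hev t)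
    exact hfix.inter ((isClosed_eq (hr.comp (hev 0)) continuous_const).inter
      (isClosed_eq (hr.comp (hev 1)) continuous_const))
  let F : C(unitInterval, ℝ × X) → ℝ := fun g => ⨆ t, J (path g t)
  have hbdd : ∀ g, BddAbove (range fun t => J (path g t)) := fun g =>
    (isCompact_range (hJ.continuous.comp (path g).continuous)).bddAbove
  have hF : LowerSemicontinuous F := lowerSemicontinuous_ciSup hbdd fun t =>
    (hJ.continuous.comp (continuous_ceramiRetraction.comp
      (continuous_eval_const t))).lowerSemicontinuous
  have hFb : ∀ g ∈ S, b ≤ F g := fun g hg => by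
    obtain ⟨t, ht⟩ := hpath (path g) hg.2.1 hg.2.2
    exact ht.trans (le_ciSup (hbdd g) t)
  have hSne : S.Nonempty := by
    let γ : C(unitInterval, X) := ⟨fun t => AffineMap.lineMap x y (t : ℝ), by fun_prop⟩
    exact ⟨lift γ, lift_mem γ (by simp [γ]) (by simp [γ])⟩
  have hFbdd : BddBelow (F '' S) := ⟨b, by rintro _ ⟨g, hg, rfl⟩; exact hFb g hg⟩
  set c := sInf (F '' S)
  have hbc : b ≤ c := le_csInf (hSne.image F) (by rintro _ ⟨g, hg, rfl⟩; exact hFb g hg)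
  have approx : ∀ ε > 0, ∃ u, c ≤ J u ∧ J u ≤ c + ε ∧ ‖fderiv ℝ J u‖ * (1 + ‖u‖) < ε := by
    intro ε hε
    obtain ⟨_, ⟨g₀, hg₀, rfl⟩, hlt⟩ := exists_lt_of_csInf_lt (hSne.image F)
      (lt_add_of_pos_right c hε)
    obtain ⟨g, hg, hle, hmin⟩ := hF.exists_forall_le_add_mul_dist hSclosed.isComplete hFb
      (show 0 < ε / 16 by positivity) hg₀
    by_contra! hno
    have hcF : c ≤ F g := csInf_le hFbdd (mem_image_of_mem F hg)
    obtain ⟨h, hpos, hh, η, hη₀, hη₁, hdist, hJη⟩ :=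
      exists_deformation_of_le_norm_fderiv hJ (path g) hε (fun t => le_ciSup (hbdd g) t)
        (show J (path g 0) < F g by
          rw [show path g 0 = x from hg.2.1]; linarith)
        (show J (path g 1) < F g by
          rw [show path g 1 = y from hg.2.2]; linarith)
        (fun t ht => hno _ (hcF.trans_eq ht.symm) (ht.trans_le (hle.trans hlt.le)))
    have hη : lift η ∈ S := lift_mem η (hη₀.trans hg.2.1) (hη₁.trans hg.2.2)
    have hFη : F (lift η) ≤ F g - h * (ε / 4) := by
      simp only [F, path_lift]
      exact ciSup_le hJη
    have hdη : dist g (lift η) ≤ 2 * h := by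
      refine (ContinuousMap.dist_le (by positivity)).2 fun t => ?_
      rw [← hg.1 t]
      exact dist_ceramiEmbedding_le hh (hdist t)
    have := hmin _ hη
    nlinarith
  choose u hu₁ hu₂ hu₃ using fun n : ℕ => approx (1 / ((n : ℝ) + 1)) (by positivity)
  have hlim := tendsto_one_div_add_atTop_nhds_zero_nat (𝕜 := ℝ)
  refine ⟨c, hbc, u, ?_, ?_⟩
  · exact tendsto_of_tendsto_of_tendsto_of_le_of_le tendsto_const_nhds
      (by simpa using hlim.const_add c) hu₁ hu₂
  · exact squeeze_zero (fun n => by positivity) (fun n => (hu₃ n).le) hlim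

end MinMax

/-- Mountain Pass Theorem under the weak Cerami--Palais--Smale condition:
if `J ∈ C¹(X,ℝ)`, `J(0) = 0`, `J` satisfies `(wCPS)_c` for every `c ∈ ℝ`, and the
mountain-pass geometry holds with radius `r₀` and level `ϱ₀ > 0` (measured in the
`W`-norm) with `‖e‖_W > r₀` and `J(e) < ϱ₀`, then `J` has a critical point `u*` with
`J(u*) ≥ ϱ₀`. -/
theorem mountain_pass {X W : Type*}
    [NormedAddCommGroup X] [NormedSpace ℝ X] [CompleteSpace X]
    [NormedAddCommGroup W] [NormedSpace ℝ W] [CompleteSpace W]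
    (ι : X →L[ℝ] W) (hι : Function.Injective ι)
    (J : X → ℝ) (hJ : ContDiff ℝ 1 J) (hJ0 : J 0 = 0)
    (hwCPS : ∀ c : ℝ, WCPS ι J c)
    (r₀ ϱ₀ : ℝ) (hr₀ : 0 < r₀) (hϱ₀ : 0 < ϱ₀) (e : X)
    (hgeom₁ : ∀ u : X, ‖ι u‖ = r₀ → ϱ₀ ≤ J u)
    (hgeom₂ : r₀ < ‖ι e‖) (hgeom₃ : J e < ϱ₀) :
    ∃ u : X, fderiv ℝ J u = 0 ∧ ϱ₀ ≤ J u := by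
  obtain ⟨c, hc, u, hu⟩ := exists_isCPSSeq_of_forall_path hJ (x := 0) (y := e) (b := ϱ₀)
    (by rwa [hJ0]) hgeom₃ fun γ h₀ h₁ => by
      have hcont : Continuous fun t => ‖ι (γ t)‖ := by fun_prop
      obtain ⟨t, ht⟩ := mem_range_of_exists_le_of_exists_ge hcont
        ⟨0, by simpa [h₀] using hr₀.le⟩ ⟨1, by simpa [h₁] using hgeom₂.le⟩
      exact ⟨t, hgeom₁ _ ht⟩
  obtain ⟨v, -, -, -, hv, hdv⟩ := hwCPS c u hu
  exact ⟨v, hdv, hc.trans_eq hv.symm⟩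
end

section
/- Let p > 1, 1 < θ ≤ p, and let a_0, Λ be real numbers with Λ ≥ a_0 > π/2 + θ/(2p). Set α_1 = (a_0 − π/2 − θ/(2p))/Λ, so that 0 < α_1 ≤ 1. Then for every real number a with a_0 ≤ a ≤ Λ and every t ∈ ℝ, one has a − arctan(|t|^θ) − (θ/p)·|t|^θ/(1 + |t|^{2θ}) ≥ α_1 (a − arctan(|t|^θ)). Equivalently, the function A(x,t) = a(x) − arctan(|t|^θ), for a measurable a with a_0 ≤ a(x) ≤ Λ a.e., satisfies condition (H_3): A(x,t) + (1/p) A_t(x,t) t ≥ α_1 A(x,t) for a.e. x and all t ∈ ℝ, where A_t(x,t) = −θ|t|^{θ−2} t/(1 + |t|^{2θ}). -/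
/-- Let `p > 1`, `1 < θ ≤ p`, and `Λ ≥ a₀ > π/2 + θ/(2p)`. Setting
`α₁ = (a₀ - π/2 - θ/(2p))/Λ`, one has `0 < α₁ ≤ 1` and, for every `a ∈ [a₀, Λ]` and
every `t ∈ ℝ`,
`a - arctan(|t|^θ) - (θ/p)|t|^θ/(1 + |t|^{2θ}) ≥ α₁ (a - arctan(|t|^θ))`,
i.e. the function `A(x,t) = a(x) - arctan(|t|^θ)` satisfies condition `(H₃)`. -/
theorem model_H3 (p θ a₀ Λ : ℝ) (hp : 1 < p) (hθ1 : 1 < θ) (hθp : θ ≤ p)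
    (ha₀ : Real.pi / 2 + θ / (2 * p) < a₀) (hΛ : a₀ ≤ Λ) :
    0 < (a₀ - Real.pi / 2 - θ / (2 * p)) / Λ ∧
    (a₀ - Real.pi / 2 - θ / (2 * p)) / Λ ≤ 1 ∧
    ∀ a t : ℝ, a₀ ≤ a → a ≤ Λ →
      (a₀ - Real.pi / 2 - θ / (2 * p)) / Λ * (a - Real.arctan (|t| ^ θ))
        ≤ a - Real.arctan (|t| ^ θ) - (θ / p) * |t| ^ θ / (1 + |t| ^ (2 * θ)) := by
  have hpi := Real.pi_pos
  have hq : 0 < θ / p := by positivity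
  have hhalf : θ / (2 * p) = θ / p / 2 := by field_simp
  rw [hhalf] at ha₀ ⊢
  have hΛ0 : 0 < Λ := by linarith
  have hα : 0 < (a₀ - Real.pi / 2 - θ / p / 2) / Λ := div_pos (by linarith) hΛ0
  refine ⟨hα, (div_le_one hΛ0).2 (by linarith), fun a t ha haΛ => ?_⟩
  have hs : 0 ≤ |t| ^ θ := by positivity
  have hsq : |t| ^ (2 * θ) = (|t| ^ θ) ^ 2 := by
    rw [mul_comm, Real.rpow_mul (abs_nonneg t), Real.rpow_two]
  rw [hsq]
  set s := |t| ^ θ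
  have harctan : 0 ≤ Real.arctan s := Real.arctan_nonneg.2 hs
  have hlt := Real.arctan_lt_pi_div_two s
  have hfrac : θ / p * s / (1 + s ^ 2) ≤ θ / p / 2 := by
    rw [div_le_div_iff₀ (by positivity) two_pos]
    nlinarith [mul_nonneg hq.le (sq_nonneg (s - 1))]
  calc (a₀ - Real.pi / 2 - θ / p / 2) / Λ * (a - Real.arctan s)
      ≤ (a₀ - Real.pi / 2 - θ / p / 2) / Λ * Λ :=
        mul_le_mul_of_nonneg_left (by linarith) hα.le
    _ = a₀ - Real.pi / 2 - θ / p / 2 := div_mul_cancel₀ _ hΛ0.ne'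
    _ ≤ _ := by linarith
end

section
/- Fix 1 < p < q, let g_1 : ℝ → ℝ be defined by g_1(t) = |t|^{q−2}t if |t| ≤ 1 and g_1(t) = |t|^{p−2}t(log|t| + 1) if |t| > 1, and set G_1(t) = ∫_0^t g_1(τ) dτ. Then g_1(t)t / G_1(t) → p as t → +∞; consequently g_1 fails the Ambrosetti–Rabinowitz condition: there exist no constants μ > p and R > 0 such that 0 < μ G_1(t) ≤ g_1(t) t for all |t| ≥ R. -/
open Filter

/-- The model nonlinearity `g₁(t) = |t|^{q-2}t` for `|t| ≤ 1`,
`g₁(t) = |t|^{p-2}t(log|t| + 1)` for `|t| > 1`. -/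
noncomputable def g1 (p q t : ℝ) : ℝ :=
  if |t| ≤ 1 then |t| ^ (q - 2) * t else |t| ^ (p - 2) * t * (Real.log |t| + 1)

/-- The primitive `G₁(t) = ∫₀ᵗ g₁(τ) dτ`. -/
noncomputable def G1 (p q t : ℝ) : ℝ := ∫ τ in (0:ℝ)..t, g1 p q τ

theorem g1_eq_rpow_of_mem_Icc (p : ℝ) {q t : ℝ} (hq : 1 < q) (ht : t ∈ Set.Icc (0 : ℝ) 1) :
    g1 p q t = t ^ (q - 1) := by
  rw [g1, abs_of_nonneg ht.1, if_pos ht.2]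
  rcases ht.1.eq_or_lt with rfl | h0
  · rw [mul_zero, Real.zero_rpow (by linarith)]
  · rw [← Real.rpow_add_one h0.ne']
    congr 1
    ring

theorem g1_eq_of_one_le (p q : ℝ) {t : ℝ} (ht : 1 ≤ t) :
    g1 p q t = t ^ (p - 1) * (Real.log t + 1) := by
  have h0 : 0 < t := by linarith
  rw [g1, abs_of_pos h0]
  split_ifs with h
  · obtain rfl : t = 1 := le_antisymm h ht
    simp
  · rw [← Real.rpow_add_one h0.ne']
    congr 2
    ring

theorem hasDerivAt_rpow_mul_log {p t : ℝ} (hp : p ≠ 0) (ht : 0 < t) :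
    HasDerivAt (fun t : ℝ => t ^ p * ((Real.log t + 1) / p - 1 / p ^ 2))
      (t ^ (p - 1) * (Real.log t + 1)) t := by
  have h1 := Real.hasDerivAt_rpow_const (x := t) (p := p) (Or.inl ht.ne')
  have h2 := (((Real.hasDerivAt_log ht.ne').add_const 1).div_const p).sub_const (1 / p ^ 2)
  refine (h1.mul h2).congr_deriv ?_
  have h3 : t ^ p = t ^ (p - 1) * t := by
    rw [← Real.rpow_add_one ht.ne']
    congr 1
    ring
  rw [h3]
  field_simp
  ring

theorem G1_eq_of_one_le {p q t : ℝ} (hp : p ≠ 0) (hq : 1 < q) (ht : 1 ≤ t) :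
    G1 p q t = G1 p q 1 - (1 / p - 1 / p ^ 2)
      + t ^ p * ((Real.log t + 1) / p - 1 / p ^ 2) := by
  have hint₁ : IntervalIntegrable (g1 p q) MeasureTheory.volume 0 1 := by
    refine ContinuousOn.intervalIntegrable ?_
    rw [Set.uIcc_of_le zero_le_one]
    refine ContinuousOn.congr ?_ fun x hx => g1_eq_rpow_of_mem_Icc p hq hx
    exact (Real.continuous_rpow_const (by linarith)).continuousOn
  have hint₂ : IntervalIntegrable (g1 p q) MeasureTheory.volume 1 t := by
    refine ContinuousOn.intervalIntegrable ?_
    rw [Set.uIcc_of_le ht]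
    refine ContinuousOn.congr ?_ fun x hx => g1_eq_of_one_le p q hx.1
    intro x hx
    have hx0 : x ≠ 0 := by linarith [hx.1]
    exact ((Real.continuousAt_rpow_const x _ (Or.inl hx0)).mul
      ((Real.continuousAt_log hx0).add continuousAt_const)).continuousWithinAt
  have hftc : ∫ τ in (1 : ℝ)..t, g1 p q τ = _ :=
    intervalIntegral.integral_eq_sub_of_hasDerivAt
      (f := fun t : ℝ => t ^ p * ((Real.log t + 1) / p - 1 / p ^ 2)) (fun x hx => by
        rw [Set.uIcc_of_le ht] at hx
        rw [g1_eq_of_one_le p q hx.1]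
        exact hasDerivAt_rpow_mul_log hp (by linarith [hx.1])) hint₂
  rw [G1, ← intervalIntegral.integral_add_adjacent_intervals hint₁ hint₂, hftc, G1]
  simp only [Real.one_rpow, Real.log_one]
  ring

theorem tendsto_g1_mul_div_G1 {p q : ℝ} (hp : 0 < p) (hq : 1 < q) :
    Tendsto (fun t : ℝ => g1 p q t * t / G1 p q t) atTop (nhds p) := by
  have hlog : Tendsto (fun t : ℝ => Real.log t + 1) atTop atTop :=
    tendsto_atTop_add_const_right _ _ Real.tendsto_log_atTop
  have hden : Tendsto (fun t : ℝ => (G1 p q 1 - (1 / p - 1 / p ^ 2)) / (t ^ p * (Real.log t + 1))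
      + (1 / p - 1 / p ^ 2 / (Real.log t + 1))) atTop (nhds (0 + (1 / p - 0))) :=
    (((tendsto_rpow_atTop hp).atTop_mul_atTop₀ hlog).const_div_atTop _).add
      (tendsto_const_nhds.sub (hlog.const_div_atTop _))
  have hinv := hden.inv₀ (by simpa using hp.ne')
  rw [zero_add, sub_zero, one_div, inv_inv] at hinv
  refine hinv.congr' ?_
  filter_upwards [eventually_ge_atTop 1] with t ht
  have h0 : 0 < t := by linarith
  have hL : 0 < Real.log t + 1 := by linarith [Real.log_nonneg ht]
  have hA : 0 < t ^ p := Real.rpow_pos_of_pos h0 p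
  have hnum : g1 p q t * t = t ^ p * (Real.log t + 1) := by
    rw [g1_eq_of_one_le p q ht, mul_right_comm, ← Real.rpow_add_one h0.ne', sub_add_cancel]
  rw [hnum, G1_eq_of_one_le hp.ne' hq ht]
  refine (congrArg Inv.inv ?_).trans (inv_div _ _)
  generalize Real.log t + 1 = L at hL
  field_simp

/-- For `1 < p < q`, `g₁(t)t / G₁(t) → p` as `t → +∞`; consequently `g₁` fails the
Ambrosetti–Rabinowitz condition: there are no `μ > p` and `R > 0` with
`0 < μ G₁(t) ≤ g₁(t) t` for all `|t| ≥ R`. -/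
theorem g1_fails_AR (p q : ℝ) (hp : 1 < p) (hpq : p < q) :
    Tendsto (fun t : ℝ => g1 p q t * t / G1 p q t) atTop (nhds p) ∧
    ¬ ∃ μ : ℝ, p < μ ∧ ∃ R : ℝ, 0 < R ∧
      ∀ t : ℝ, R ≤ |t| → 0 < μ * G1 p q t ∧ μ * G1 p q t ≤ g1 p q t * t := by
  have hlim := tendsto_g1_mul_div_G1 (p := p) (q := q) (by linarith) (by linarith)
  refine ⟨hlim, ?_⟩
  rintro ⟨μ, hμ, R, hR, h⟩
  refine absurd (ge_of_tendsto hlim ?_) hμ.not_ge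
  filter_upwards [eventually_ge_atTop R] with t ht
  obtain ⟨hpos, hle⟩ := h t (ht.trans (le_abs_self t))
  have hG : 0 < G1 p q t := pos_of_mul_pos_right hpos (by linarith)
  rwa [le_div_iff₀ hG]
end
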